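/- Under the stated model, the MRT precoder with inverse calibration W_IC = a H_bt⁻¹ H* + b H_bt⁻¹ (H_br*)⁻¹ N_u* satisfies E[tr(W_IC W_ICᴴ)] = M K E_2̄^t (a² + b² E_2̄^r); consequently the power-normalization parameter equals λ_IC = (M K E_2̄^t (a² + b² E_2̄^r))^{-1/2}. -/

import Mathlib

open MeasureTheory ProbabilityTheory Matrix
open scoped NNReal

noncomputable section

/-- The standard circularly symmetric complex Gaussian distribution `CN(0,1)`:
`z = x + i y` with `x, y` independent real Gaussians of mean `0` and variance `1/2`. -/
def cgauss : Measure ℂ :=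
  Measure.map (fun p : ℝ × ℝ => (p.1 : ℂ) + (p.2 : ℂ) * Complex.I)
    ((gaussianReal 0 (1 / 2 : ℝ≥0)).prod (gaussianReal 0 (1 / 2 : ℝ≥0)))

/-- The truncated Gaussian distribution `N_T(m, σ²)` on `[a, b]`: a real Gaussian with mean `m`
and variance `σ²` conditioned on the event of lying in the interval `[a, b]`. -/
def truncGauss (m σ a b : ℝ) : Measure ℝ :=
  ProbabilityTheory.cond (gaussianReal m ⟨σ ^ 2, sq_nonneg σ⟩) (Set.Icc a b)

/-- Canonical sample space of the channel model: the entries of `H`, the entries of `N_u`,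
the transmit amplitudes `A_bt`, the transmit phases `φ_bt`, the receive amplitudes `A_br`
and the receive phases `φ_br`. -/
abbrev ModelΩ (M K : ℕ) :=
  (Fin M → Fin K → ℂ) × (Fin M → Fin K → ℂ) ×
    (Fin M → ℝ) × (Fin M → ℝ) × (Fin M → ℝ) × (Fin M → ℝ)

/-- Joint law of `(H, N_u, A_bt, φ_bt, A_br, φ_br)`: all components are mutually independent,
the entries of `H` and `N_u` are i.i.d. `CN(0,1)`, the transmit (resp. receive) amplitudes are
i.i.d. with law `νt` (resp. `νr`), and the transmit (resp. receive) phases are i.i.d. with law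
`μφt` (resp. `μφr`). -/
def modelP (M K : ℕ) (νt νr μφt μφr : Measure ℝ) : Measure (ModelΩ M K) :=
  (Measure.pi fun _ : Fin M => Measure.pi fun _ : Fin K => cgauss).prod
    ((Measure.pi fun _ : Fin M => Measure.pi fun _ : Fin K => cgauss).prod
      ((Measure.pi fun _ : Fin M => νt).prod
        ((Measure.pi fun _ : Fin M => μφt).prod
          ((Measure.pi fun _ : Fin M => νr).prod (Measure.pi fun _ : Fin M => μφr)))))

/-- The propagation channel matrix `H`. -/
def Hmat {M K : ℕ} (ω : ModelΩ M K) : Matrix (Fin M) (Fin K) ℂ := Matrix.of ω.1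

/-- The channel-estimation noise matrix `N_u`. -/
def Nmat {M K : ℕ} (ω : ModelΩ M K) : Matrix (Fin M) (Fin K) ℂ := Matrix.of ω.2.1

/-- The diagonal transmit RF-frontend response matrix `H_bt`, with `j`-th diagonal entry
`A_bt,j · e^{i φ_bt,j}`. -/
def HbtMat {M K : ℕ} (ω : ModelΩ M K) : Matrix (Fin M) (Fin M) ℂ :=
  Matrix.diagonal fun j => (ω.2.2.1 j : ℂ) * Complex.exp (Complex.I * (ω.2.2.2.1 j : ℂ))

/-- The diagonal receive RF-frontend response matrix `H_br`, with `j`-th diagonal entry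
`A_br,j · e^{i φ_br,j}`. -/
def HbrMat {M K : ℕ} (ω : ModelΩ M K) : Matrix (Fin M) (Fin M) ℂ :=
  Matrix.diagonal fun j => (ω.2.2.2.2.1 j : ℂ) * Complex.exp (Complex.I * (ω.2.2.2.2.2 j : ℂ))

/-- The MRT precoder with inverse calibration:
`W_IC = a H_bt⁻¹ H* + b H_bt⁻¹ (H_br*)⁻¹ N_u*`. -/
def W_IC {M K : ℕ} (a b : ℝ) (ω : ModelΩ M K) : Matrix (Fin M) (Fin K) ℂ :=
  (a : ℂ) • ((HbtMat ω)⁻¹ * (Hmat ω).map (starRingEnd ℂ)) +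
    (b : ℂ) • ((HbtMat ω)⁻¹ * ((HbrMat ω).map (starRingEnd ℂ))⁻¹ *
      (Nmat ω).map (starRingEnd ℂ))

/-- The MRT precoder with relative calibration:
`W_RC = a H_bt* H* + b H_bt* (H_br*)⁻¹ N_u*`. -/
def W_RC {M K : ℕ} (a b : ℝ) (ω : ModelΩ M K) : Matrix (Fin M) (Fin K) ℂ :=
  (a : ℂ) • ((HbtMat ω).map (starRingEnd ℂ) * (Hmat ω).map (starRingEnd ℂ)) +
    (b : ℂ) • ((HbtMat ω).map (starRingEnd ℂ) * ((HbrMat ω).map (starRingEnd ℂ))⁻¹ *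
      (Nmat ω).map (starRingEnd ℂ))

/-- The entries at row `j` and column `k` of all the random objects of the model. -/
def modelEntry {M K : ℕ} (j : Fin M) (k : Fin K) (ω : ModelΩ M K) : ℂ × ℂ × ℝ × ℝ × ℝ × ℝ :=
  (ω.1 j k, ω.2.1 j k, ω.2.2.1 j, ω.2.2.2.1 j, ω.2.2.2.2.1 j, ω.2.2.2.2.2 j)

instance isProbabilityMeasure_cgauss : IsProbabilityMeasure cgauss :=
  Measure.isProbabilityMeasure_map (by fun_prop)

lemma integrable_cgauss_iff {f : ℂ → ℂ} (hf : Continuous f) :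
    Integrable f cgauss ↔ Integrable (fun p : ℝ × ℝ => f ((p.1 : ℂ) + (p.2 : ℂ) * Complex.I))
      ((gaussianReal 0 (1 / 2 : ℝ≥0)).prod (gaussianReal 0 (1 / 2 : ℝ≥0))) :=
  integrable_map_measure hf.aestronglyMeasurable (by fun_prop)

lemma integral_cgauss {f : ℂ → ℂ} (hf : Continuous f) :
    ∫ z, f z ∂cgauss = ∫ p : ℝ × ℝ, f ((p.1 : ℂ) + (p.2 : ℂ) * Complex.I)
      ∂(gaussianReal 0 (1 / 2 : ℝ≥0)).prod (gaussianReal 0 (1 / 2 : ℝ≥0)) :=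
  integral_map (by fun_prop) hf.aestronglyMeasurable

lemma integrable_ofReal_gaussianReal (m : ℝ) (v : ℝ≥0) :
    Integrable (fun x : ℝ => (x : ℂ)) (gaussianReal m v) :=
  ((memLp_id_gaussianReal 1).integrable le_rfl).ofReal

lemma integrable_ofReal_sq_gaussianReal (m : ℝ) (v : ℝ≥0) :
    Integrable (fun x : ℝ => (x : ℂ) ^ 2) (gaussianReal m v) := by
  simpa using ((memLp_id_gaussianReal (μ := m) (v := v) 2).integrable_sq).ofReal (𝕜 := ℂ)

lemma integral_ofReal_sq_gaussianReal_zero (v : ℝ≥0) :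
    ∫ x : ℝ, (x : ℂ) ^ 2 ∂gaussianReal 0 v = (v : ℝ) := by
  have h : ∫ x : ℝ, x ^ 2 ∂gaussianReal 0 v = v := by
    have h₁ := variance_of_integral_eq_zero (X := id) (μ := gaussianReal 0 v)
      aemeasurable_id (by simp)
    rw [variance_id_gaussianReal] at h₁
    simpa using h₁.symm
  rw [← h, ← integral_complex_ofReal]
  simp

lemma integrable_id_cgauss : Integrable (fun z : ℂ => z) cgauss := by
  rw [integrable_cgauss_iff (f := fun z => z) continuous_id]
  exact ((integrable_ofReal_gaussianReal 0 _).comp_fst _).add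
    (((integrable_ofReal_gaussianReal 0 _).comp_snd _).mul_const _)

lemma integral_id_cgauss : ∫ z, z ∂cgauss = 0 := by
  rw [integral_cgauss (f := fun z => z) continuous_id, integral_add
    ((integrable_ofReal_gaussianReal 0 _).comp_fst _)
    (((integrable_ofReal_gaussianReal 0 _).comp_snd _).mul_const _), integral_mul_const,
    integral_fun_fst (fun x : ℝ => (x : ℂ)), integral_fun_snd (fun x : ℝ => (x : ℂ)),
    integral_complex_ofReal]
  simp

lemma integrable_conj_cgauss : Integrable (fun z : ℂ => starRingEnd ℂ z) cgauss :=
  Complex.conjLIE.toContinuousLinearEquiv.toContinuousLinearMap.integrable_comp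
    integrable_id_cgauss

lemma integral_conj_cgauss : ∫ z, starRingEnd ℂ z ∂cgauss = 0 := by
  rw [integral_conj, integral_id_cgauss, map_zero]

lemma mul_conj_ofReal_add_ofReal_mul_I (x y : ℝ) :
    ((x : ℂ) + y * Complex.I) * starRingEnd ℂ ((x : ℂ) + y * Complex.I) =
      (x : ℂ) ^ 2 + (y : ℂ) ^ 2 := by
  simp only [map_add, map_mul, Complex.conj_ofReal, Complex.conj_I]
  linear_combination -(y : ℂ) ^ 2 * Complex.I_sq

lemma integrable_mul_conj_cgauss : Integrable (fun z : ℂ => z * starRingEnd ℂ z) cgauss := by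
  rw [integrable_cgauss_iff (by fun_prop)]
  simp only [mul_conj_ofReal_add_ofReal_mul_I]
  exact ((integrable_ofReal_sq_gaussianReal 0 _).comp_fst _).add
    ((integrable_ofReal_sq_gaussianReal 0 _).comp_snd _)

lemma integral_mul_conj_cgauss : ∫ z, z * starRingEnd ℂ z ∂cgauss = 1 := by
  rw [integral_cgauss (by fun_prop)]
  simp only [mul_conj_ofReal_add_ofReal_mul_I]
  rw [integral_add ((integrable_ofReal_sq_gaussianReal 0 _).comp_fst _)
    ((integrable_ofReal_sq_gaussianReal 0 _).comp_snd _),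
    integral_fun_fst (fun x : ℝ => (x : ℂ) ^ 2), integral_fun_snd (fun x : ℝ => (x : ℂ) ^ 2),
    integral_ofReal_sq_gaussianReal_zero]
  norm_num

lemma isProbabilityMeasure_truncGauss (m : ℝ) {σ c d : ℝ} (hσ : 0 < σ) (hcd : c < d) :
    IsProbabilityMeasure (truncGauss m σ c d) := by
  have : IsProbabilityMeasure (gaussianReal m ⟨σ ^ 2, sq_nonneg σ⟩) :=
    instIsProbabilityMeasureGaussianReal m _
  apply cond_isProbabilityMeasure
  have hv : (⟨σ ^ 2, sq_nonneg σ⟩ : ℝ≥0) ≠ 0 := by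
    intro h
    exact (pow_pos hσ 2).ne' (congrArg NNReal.toReal h)
  intro h
  have := gaussianReal_absolutelyContinuous' m hv h
  simp only [Real.volume_Icc, ENNReal.ofReal_eq_zero, sub_nonpos] at this
  exact absurd this (not_le.mpr hcd)

lemma ae_pos_truncGauss (m σ : ℝ) {c : ℝ} (d : ℝ) (hc : 0 < c) :
    ∀ᵐ x ∂truncGauss m σ c d, 0 < x := by
  filter_upwards [ae_cond_mem (μ := gaussianReal m ⟨σ ^ 2, sq_nonneg σ⟩)
    (measurableSet_Icc (a := c) (b := d))] with x hx
  exact hc.trans_le hx.1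

lemma integrable_truncGauss_of_continuousOn (m : ℝ) {σ c d : ℝ} (hσ : 0 < σ) (hcd : c < d)
    {f : ℝ → ℂ} (hf : ContinuousOn f (Set.Icc c d)) : Integrable f (truncGauss m σ c d) := by
  have hμ : gaussianReal m ⟨σ ^ 2, sq_nonneg σ⟩ (Set.Icc c d) ≠ 0 := by
    intro h
    have := isProbabilityMeasure_truncGauss m hσ hcd
    exact IsProbabilityMeasure.ne_zero (truncGauss m σ c d) (cond_eq_zero_of_meas_eq_zero h)
  have : IsProbabilityMeasure (gaussianReal m ⟨σ ^ 2, sq_nonneg σ⟩) :=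
    instIsProbabilityMeasureGaussianReal m _
  exact (hf.integrableOn_compact isCompact_Icc).smul_measure (ENNReal.inv_ne_top.mpr hμ)

lemma integrable_inv_sq_truncGauss (m : ℝ) {σ c d : ℝ} (hσ : 0 < σ) (hc : 0 < c) (hcd : c < d) :
    Integrable (fun x : ℝ => ((x : ℂ) ^ 2)⁻¹) (truncGauss m σ c d) :=
  integrable_truncGauss_of_continuousOn m hσ hcd <|
    ContinuousOn.inv₀ (by fun_prop) fun x hx =>
      pow_ne_zero 2 (Complex.ofReal_ne_zero.mpr (hc.trans_le hx.1).ne')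

lemma integrable_inv_truncGauss (m : ℝ) {σ c d : ℝ} (hσ : 0 < σ) (hc : 0 < c) (hcd : c < d) :
    Integrable (fun x : ℝ => (x : ℂ)⁻¹) (truncGauss m σ c d) :=
  integrable_truncGauss_of_continuousOn m hσ hcd <|
    ContinuousOn.inv₀ (by fun_prop) fun x hx =>
      Complex.ofReal_ne_zero.mpr (hc.trans_le hx.1).ne'

lemma integrable_exp_I_mul (μ : Measure ℝ) [IsFiniteMeasure μ] :
    Integrable (fun x : ℝ => Complex.exp (Complex.I * x)) μ :=
  Integrable.of_bound (by fun_prop) 1 (ae_of_all _ fun x => by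
    rw [mul_comm, Complex.norm_exp_ofReal_mul_I])

lemma integrable_exp_neg_I_mul (μ : Measure ℝ) [IsFiniteMeasure μ] :
    Integrable (fun x : ℝ => Complex.exp (-(Complex.I * x))) μ :=
  Integrable.of_bound (by fun_prop) 1 (ae_of_all _ fun x => by
    rw [mul_comm, ← neg_mul, ← Complex.ofReal_neg, Complex.norm_exp_ofReal_mul_I])

section

variable {M K : ℕ} (νt νr μφt μφr : Measure ℝ) [IsProbabilityMeasure νt]
  [IsProbabilityMeasure νr] [IsProbabilityMeasure μφt] [IsProbabilityMeasure μφr]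

lemma measurePreserving_modelEntry (j : Fin M) (k : Fin K) :
    MeasurePreserving (modelEntry j k) (modelP M K νt νr μφt μφr)
      (cgauss.prod (cgauss.prod (νt.prod (μφt.prod (νr.prod μφr))))) := by
  have hC : MeasurePreserving (fun A : Fin M → Fin K → ℂ => A j k)
      (Measure.pi fun _ : Fin M => Measure.pi fun _ : Fin K => cgauss) cgauss :=
    (measurePreserving_eval (fun _ : Fin K => cgauss) k).comp
      (measurePreserving_eval (fun _ : Fin M => Measure.pi fun _ : Fin K => cgauss) j)
  exact hC.prod <| hC.prod <| (measurePreserving_eval (fun _ => νt) j).prod <|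
    (measurePreserving_eval (fun _ => μφt) j).prod <|
    (measurePreserving_eval (fun _ => νr) j).prod (measurePreserving_eval (fun _ => μφr) j)

lemma ae_modelP_amplitudes_pos (hK : 0 < K) (ht : ∀ᵐ x ∂νt, 0 < x) (hr : ∀ᵐ x ∂νr, 0 < x) :
    ∀ᵐ ω ∂modelP M K νt νr μφt μφr, ∀ j, 0 < ω.2.2.1 j ∧ 0 < ω.2.2.2.2.1 j := by
  rw [ae_all_iff]
  intro j
  have h := (measurePreserving_modelEntry νt νr μφt μφr j ⟨0, hK⟩).quasiMeasurePreserving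
  have h₁ := h.ae ((Measure.quasiMeasurePreserving_snd.ae
    (Measure.quasiMeasurePreserving_snd.ae (Measure.quasiMeasurePreserving_fst.ae ht))))
  have h₂ := h.ae (Measure.quasiMeasurePreserving_snd.ae (Measure.quasiMeasurePreserving_snd.ae
    (Measure.quasiMeasurePreserving_snd.ae (Measure.quasiMeasurePreserving_snd.ae
      (Measure.quasiMeasurePreserving_fst.ae hr)))))
  filter_upwards [h₁, h₂] with ω hω₁ hω₂ using ⟨hω₁, hω₂⟩

variable {νt νr μφt μφr} in
lemma hasIntegral_modelP_prod (j : Fin M) (k : Fin K) {f g : ℂ → ℂ} {p q s : ℝ → ℂ}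
    (hf : Integrable f cgauss) (hg : Integrable g cgauss) (hp : Integrable p νt)
    (hq : Integrable q νr) (hs : Integrable s μφr) :
    Integrable (fun ω : ModelΩ M K => f (ω.1 j k) * (g (ω.2.1 j k) * (p (ω.2.2.1 j) *
        (q (ω.2.2.2.2.1 j) * s (ω.2.2.2.2.2 j))))) (modelP M K νt νr μφt μφr) ∧
      ∫ ω : ModelΩ M K, f (ω.1 j k) * (g (ω.2.1 j k) * (p (ω.2.2.1 j) *
        (q (ω.2.2.2.2.1 j) * s (ω.2.2.2.2.2 j)))) ∂modelP M K νt νr μφt μφr =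
      (∫ z, f z ∂cgauss) * ((∫ z, g z ∂cgauss) * ((∫ x, p x ∂νt) *
        ((∫ x, q x ∂νr) * ∫ x, s x ∂μφr))) := by
  have hmp := measurePreserving_modelEntry νt νr μφt μφr j k
  have hint := hf.mul_prod (hg.mul_prod (hp.mul_prod ((hq.mul_prod hs).comp_snd μφt)))
  refine ⟨hmp.integrable_comp_of_integrable hint, ?_⟩
  have h := integral_map hmp.measurable.aemeasurable
    (by rw [hmp.map_eq]; exact hint.aestronglyMeasurable)
  rw [hmp.map_eq] at h
  refine h.symm.trans ?_
  rw [integral_prod_mul f (fun y : ℂ × ℝ × ℝ × ℝ × ℝ =>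
      g y.1 * (p y.2.1 * (q y.2.2.2.1 * s y.2.2.2.2))),
    integral_prod_mul g (fun y : ℝ × ℝ × ℝ × ℝ => p y.1 * (q y.2.2.1 * s y.2.2.2)),
    integral_prod_mul p (fun y : ℝ × ℝ × ℝ => q y.2.1 * s y.2.2),
    integral_fun_snd (fun y : ℝ × ℝ => q y.1 * s y.2), integral_prod_mul q s]
  simp

end

lemma inv_diagonal_of_ne_zero {n : Type*} [Fintype n] [DecidableEq n] {v : n → ℂ}
    (hv : ∀ i, v i ≠ 0) : (diagonal v)⁻¹ = diagonal fun i => (v i)⁻¹ := by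
  apply inv_eq_left_inv
  rw [diagonal_mul_diagonal, ← diagonal_one]
  congr 1
  ext i
  exact inv_mul_cancel₀ (hv i)

/-- The power of the `(j, k)` entry of `W_IC`, expanded into products of independent factors. -/
def entryPower {M K : ℕ} (a b : ℝ) (j : Fin M) (k : Fin K) (ω : ModelΩ M K) : ℂ :=
  (a : ℂ) ^ 2 * (ω.1 j k * starRingEnd ℂ (ω.1 j k) * (1 * (((ω.2.2.1 j : ℂ) ^ 2)⁻¹ * (1 * 1)))) +
  (b : ℂ) ^ 2 * (1 * (ω.2.1 j k * starRingEnd ℂ (ω.2.1 j k) * (((ω.2.2.1 j : ℂ) ^ 2)⁻¹ *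
    (((ω.2.2.2.2.1 j : ℂ) ^ 2)⁻¹ * 1)))) +
  (a * b : ℂ) * (starRingEnd ℂ (ω.1 j k) * (ω.2.1 j k * (((ω.2.2.1 j : ℂ) ^ 2)⁻¹ *
    ((ω.2.2.2.2.1 j : ℂ)⁻¹ * Complex.exp (-(Complex.I * ω.2.2.2.2.2 j)))))) +
  (a * b : ℂ) * (ω.1 j k * (starRingEnd ℂ (ω.2.1 j k) * (((ω.2.2.1 j : ℂ) ^ 2)⁻¹ *
    ((ω.2.2.2.2.1 j : ℂ)⁻¹ * Complex.exp (Complex.I * ω.2.2.2.2.2 j)))))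

lemma trace_W_IC_mul_conjTranspose {M K : ℕ} (a b : ℝ) (ω : ModelΩ M K)
    (hω : ∀ j, 0 < ω.2.2.1 j ∧ 0 < ω.2.2.2.2.1 j) :
    Matrix.trace (W_IC a b ω * (W_IC a b ω)ᴴ) = ∑ j, ∑ k, entryPower a b j k ω := by
  have ht : ∀ j, (ω.2.2.1 j : ℂ) * Complex.exp (Complex.I * (ω.2.2.2.1 j : ℂ)) ≠ 0 := fun j =>
    mul_ne_zero (Complex.ofReal_ne_zero.mpr (hω j).1.ne') (Complex.exp_ne_zero _)
  have hr : ∀ j, starRingEnd ℂ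
      ((ω.2.2.2.2.1 j : ℂ) * Complex.exp (Complex.I * (ω.2.2.2.2.2 j : ℂ))) ≠ 0 := fun j =>
    (map_ne_zero _).mpr
      (mul_ne_zero (Complex.ofReal_ne_zero.mpr (hω j).2.ne') (Complex.exp_ne_zero _))
  simp only [Matrix.trace, Matrix.diag_apply, Matrix.mul_apply, Matrix.conjTranspose_apply]
  refine Finset.sum_congr rfl fun j _ => Finset.sum_congr rfl fun k _ => ?_
  rw [W_IC, HbtMat, HbrMat, diagonal_map (map_zero _), inv_diagonal_of_ne_zero ht,
    inv_diagonal_of_ne_zero hr, diagonal_mul_diagonal]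
  simp only [Matrix.add_apply, Matrix.smul_apply, diagonal_mul, Matrix.map_apply, Hmat, Nmat,
    Matrix.of_apply, smul_eq_mul, RCLike.star_def, map_add, map_mul, map_neg, map_inv₀, Complex.conj_conj,
    Complex.conj_ofReal, ← Complex.exp_conj, Complex.conj_I, mul_inv, ← Complex.exp_neg,
    neg_mul, neg_neg, entryPower]
  have e₁ := Complex.exp_add (Complex.I * (ω.2.2.2.1 j : ℂ)) (-(Complex.I * (ω.2.2.2.1 j : ℂ)))
  have e₂ := Complex.exp_add (Complex.I * (ω.2.2.2.2.2 j : ℂ))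
    (-(Complex.I * (ω.2.2.2.2.2 j : ℂ)))
  rw [add_neg_cancel, Complex.exp_zero] at e₁ e₂
  generalize Complex.exp (Complex.I * (ω.2.2.2.1 j : ℂ)) = u at *
  generalize Complex.exp (-(Complex.I * (ω.2.2.2.1 j : ℂ))) = u' at *
  generalize Complex.exp (Complex.I * (ω.2.2.2.2.2 j : ℂ)) = w at *
  generalize Complex.exp (-(Complex.I * (ω.2.2.2.2.2 j : ℂ))) = w' at *
  rw [← inv_pow, ← inv_pow]
  generalize (ω.2.2.1 j : ℂ)⁻¹ = p
  generalize (ω.2.2.2.2.1 j : ℂ)⁻¹ = q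
  generalize ω.1 j k = h
  generalize ω.2.1 j k = n
  generalize starRingEnd ℂ h = h'
  generalize starRingEnd ℂ n = n'
  linear_combination (-p ^ 2 * (a * h' + b * q * w * n') * (a * h + b * q * w' * n)) * e₁ -
    p ^ 2 * b ^ 2 * q ^ 2 * n * n' * e₂

/-- `E[tr(W_IC W_ICᴴ)] = M K E_2̄^t (a² + b² E_2̄^r)`, and consequently the power-normalization
parameter equals `λ_IC = (M K E_2̄^t (a² + b² E_2̄^r))^{-1/2}`. -/
theorem inverse_calibration_power_normalization
    (M K : ℕ) (hM : 0 < M) (hK : 0 < K)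
    (a b : ℝ) (hab : a ≠ 0 ∨ b ≠ 0)
    (mt σt ct dt mr σr cr dr : ℝ)
    (hσt : 0 < σt) (hct : 0 < ct) (hctdt : ct < dt)
    (hσr : 0 < σr) (hcr : 0 < cr) (hcrdr : cr < dr)
    (μφt μφr : Measure ℝ) [IsProbabilityMeasure μφt] [IsProbabilityMeasure μφr]
    (E2t E2r : ℝ)
    (hE2t : E2t = ∫ x, (x ^ 2)⁻¹ ∂truncGauss mt σt ct dt)
    (hE2r : E2r = ∫ x, (x ^ 2)⁻¹ ∂truncGauss mr σr cr dr) :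
    (∫ ω, Matrix.trace (W_IC a b ω * (W_IC a b ω)ᴴ)
        ∂modelP M K (truncGauss mt σt ct dt) (truncGauss mr σr cr dr) μφt μφr) =
      ((M : ℂ) * K * E2t * (a ^ 2 + b ^ 2 * E2r)) ∧
    (Real.sqrt (∫ ω, (Matrix.trace (W_IC a b ω * (W_IC a b ω)ᴴ)).re
        ∂modelP M K (truncGauss mt σt ct dt) (truncGauss mr σr cr dr) μφt μφr))⁻¹ =
      (Real.sqrt ((M : ℝ) * K * E2t * (a ^ 2 + b ^ 2 * E2r)))⁻¹ := by
  have := isProbabilityMeasure_truncGauss mt hσt hctdt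
  have := isProbabilityMeasure_truncGauss mr hσr hcrdr
  have hp := integrable_inv_sq_truncGauss mt hσt hct hctdt
  have hq := integrable_inv_sq_truncGauss mr hσr hcr hcrdr
  have hq' := integrable_inv_truncGauss mr hσr hcr hcrdr
  have ht : ∫ x : ℝ, ((x : ℂ) ^ 2)⁻¹ ∂truncGauss mt σt ct dt = E2t := by
    rw [hE2t, ← integral_complex_ofReal]
    simp
  have hr : ∫ x : ℝ, ((x : ℂ) ^ 2)⁻¹ ∂truncGauss mr σr cr dr = E2r := by
    rw [hE2r, ← integral_complex_ofReal]
    simp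
  have key (j : Fin M) (k : Fin K) : Integrable (entryPower a b j k)
        (modelP M K (truncGauss mt σt ct dt) (truncGauss mr σr cr dr) μφt μφr) ∧
      ∫ ω, entryPower a b j k ω
        ∂modelP M K (truncGauss mt σt ct dt) (truncGauss mr σr cr dr) μφt μφr =
        E2t * (a ^ 2 + b ^ 2 * E2r) := by
    obtain ⟨i₁, v₁⟩ := hasIntegral_modelP_prod (μφt := μφt) (μφr := μφr) j k
      integrable_mul_conj_cgauss (integrable_const 1) hp
      (integrable_const (μ := truncGauss mr σr cr dr) 1) (integrable_const 1)
    obtain ⟨i₂, v₂⟩ := hasIntegral_modelP_prod (μφt := μφt) (μφr := μφr) j k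
      (integrable_const 1) integrable_mul_conj_cgauss hp hq (integrable_const 1)
    obtain ⟨i₃, v₃⟩ := hasIntegral_modelP_prod (μφt := μφt) j k
      integrable_conj_cgauss integrable_id_cgauss hp hq' (integrable_exp_neg_I_mul μφr)
    obtain ⟨i₄, v₄⟩ := hasIntegral_modelP_prod (μφt := μφt) j k
      integrable_id_cgauss integrable_conj_cgauss hp hq' (integrable_exp_I_mul μφr)
    have j₁ := i₁.const_mul ((a : ℂ) ^ 2)
    have j₂ := i₂.const_mul ((b : ℂ) ^ 2)
    have j₃ := i₃.const_mul (a * b : ℂ)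
    have j₄ := i₄.const_mul (a * b : ℂ)
    refine ⟨((j₁.add j₂).add j₃).add j₄, ?_⟩
    refine (integral_add ((j₁.add j₂).add j₃) j₄).trans ?_
    rw [integral_add' (j₁.add j₂) j₃, integral_add' j₁ j₂]
    simp only [integral_const_mul ((a : ℂ) ^ 2), integral_const_mul ((b : ℂ) ^ 2),
      integral_const_mul (a * b : ℂ)]
    rw [v₁, v₂, v₃, v₄, integral_mul_conj_cgauss, integral_id_cgauss, integral_conj_cgauss, ht, hr]
    simp only [integral_const, probReal_univ, one_smul]
    ring
  have hae : (fun ω => Matrix.trace (W_IC a b ω * (W_IC a b ω)ᴴ))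
      =ᵐ[modelP M K (truncGauss mt σt ct dt) (truncGauss mr σr cr dr) μφt μφr]
      fun ω => ∑ j, ∑ k, entryPower a b j k ω := by
    filter_upwards [ae_modelP_amplitudes_pos _ _ μφt μφr hK (ae_pos_truncGauss mt σt dt hct)
      (ae_pos_truncGauss mr σr dr hcr)] with ω hω
    exact trace_W_IC_mul_conjTranspose a b ω hω
  have hsum := integrable_finsetSum Finset.univ fun j (_ : j ∈ Finset.univ) =>
    integrable_finsetSum Finset.univ fun k (_ : k ∈ Finset.univ) => (key j k).1
  have htrace : (∫ ω, Matrix.trace (W_IC a b ω * (W_IC a b ω)ᴴ)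
      ∂modelP M K (truncGauss mt σt ct dt) (truncGauss mr σr cr dr) μφt μφr) =
      ((M : ℂ) * K * E2t * (a ^ 2 + b ^ 2 * E2r)) := by
    rw [integral_congr_ae hae, integral_finsetSum _ fun j _ =>
      integrable_finsetSum _ fun k _ => (key j k).1]
    simp_rw [integral_finsetSum _ fun k _ => (key _ k).1, (key _ _).2]
    simp only [Finset.sum_const, Finset.card_univ, Fintype.card_fin, nsmul_eq_mul]
    ring
  refine ⟨htrace, ?_⟩
  have hre := integral_re (𝕜 := ℂ) (hsum.congr hae.symm)
  simp only [RCLike.re_eq_complex_re] at hre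
  rw [hre, htrace]
  congr 2
  norm_cast
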